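/- arXiv:1703.08852 — 3 statements merged into one kernel-verified Lean document; each statement's English description precedes it below -/
import Mathlib

section
/- Fix x, y > 0. For all p₁, p₂, q₁, q₂ > 0 and all α ∈ [0,1], the extended (p,q)-beta function satisfies B_{α p₁ + (1−α) p₂, α q₁ + (1−α) q₂}(x, y) ≤ (B_{p₁,q₁}(x,y))^α · (B_{p₂,q₂}(x,y))^{1−α}; that is, the map (p,q) ↦ B_{p,q}(x,y) is log-convex on (0,∞) × (0,∞). -/
/-- The extended `(p,q)`-beta function
`B_{p,q}(x,y) = ∫₀¹ t^(x-1) (1-t)^(y-1) exp(-p/t - q/(1-t)) dt`. -/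
noncomputable def extBeta (p q x y : ℝ) : ℝ :=
  ∫ t in (0:ℝ)..1, t ^ (x - 1) * (1 - t) ^ (y - 1) * Real.exp (-p / t - q / (1 - t))

open MeasureTheory Set in
/-- Hölder's inequality in its log-convexity form. -/
theorem integral_rpow_mul_rpow_le {Ω : Type*} [MeasurableSpace Ω] {μ : Measure Ω} {f g : Ω → ℝ}
    (hf₀ : 0 ≤ᵐ[μ] f) (hg₀ : 0 ≤ᵐ[μ] g) (hf : Integrable f μ) (hg : Integrable g μ)
    {a b : ℝ} (ha : 0 ≤ a) (hb : 0 ≤ b) (hab : a + b = 1) :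
    ∫ t, f t ^ a * g t ^ b ∂μ ≤ (∫ t, f t ∂μ) ^ a * (∫ t, g t ∂μ) ^ b := by
  have key : ∀ {h : Ω → ℝ} {c : ℝ}, 0 ≤ᵐ[μ] h → Integrable h μ → 0 < c →
      MemLp (fun t ↦ h t ^ c) (ENNReal.ofReal c⁻¹) μ ∧
        ∫ t, (h t ^ c) ^ c⁻¹ ∂μ = ∫ t, h t ∂μ := by
    intro h c h₀ hi hc
    refine ⟨?_, integral_congr_ae ?_⟩
    · have := (memLp_one_iff_integrable.2 hi).norm_rpow_div (ENNReal.ofReal c)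
      rw [ENNReal.toReal_ofReal hc.le, one_div, ← ENNReal.ofReal_inv_of_pos hc] at this
      refine (memLp_congr_ae ?_).1 this
      filter_upwards [h₀] with t ht
      rw [Real.norm_of_nonneg ht]
    · filter_upwards [h₀] with t ht
      exact Real.rpow_rpow_inv ht hc.ne'
  rcases ha.eq_or_lt with rfl | ha
  · obtain rfl : b = 1 := by linarith
    simp
  rcases hb.eq_or_lt with rfl | hb
  · obtain rfl : a = 1 := by linarith
    simp
  obtain ⟨hf_mem, hf_int⟩ := key hf₀ hf ha
  obtain ⟨hg_mem, hg_int⟩ := key hg₀ hg hb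
  have holder := integral_mul_le_Lp_mul_Lq_of_nonneg
    (Real.HolderConjugate.inv_inv ha hb hab)
    (hf₀.mono fun t ht ↦ Real.rpow_nonneg ht a) (hg₀.mono fun t ht ↦ Real.rpow_nonneg ht b)
    hf_mem hg_mem
  rwa [hf_int, hg_int, one_div, one_div, inv_inv, inv_inv] at holder

/-- The integrand of Euler's beta integral is integrable. -/
theorem intervalIntegrable_rpow_mul_one_sub_rpow {x y : ℝ} (hx : 0 < x) (hy : 0 < y) :
    IntervalIntegrable (fun t : ℝ ↦ t ^ (x - 1) * (1 - t) ^ (y - 1)) MeasureTheory.volume 0 1 := by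
  have h := (Complex.betaIntegral_convergent (u := x) (v := y) (by simpa) (by simpa)).norm
  rw [intervalIntegrable_iff_integrableOn_Ioo_of_le zero_le_one] at h ⊢
  refine h.congr_fun (fun t ht ↦ ?_) measurableSet_Ioo
  have h₁ : 0 < 1 - t := sub_pos.2 ht.2
  have e₁ : ‖(t : ℂ) ^ ((x : ℂ) - 1)‖ = t ^ (x - 1) := by
    rw [Complex.norm_cpow_eq_rpow_re_of_pos ht.1]; simp
  have e₂ : ‖(1 - (t : ℂ)) ^ ((y : ℂ) - 1)‖ = (1 - t) ^ (y - 1) := by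
    rw [← Complex.ofReal_one, ← Complex.ofReal_sub, Complex.norm_cpow_eq_rpow_re_of_pos h₁]; simp
  simp only [norm_mul, e₁, e₂]

open MeasureTheory Set in
theorem integrableOn_extBeta_integrand {p q x y : ℝ} (hp : 0 ≤ p) (hq : 0 ≤ q)
    (hx : 0 < x) (hy : 0 < y) :
    IntegrableOn (fun t : ℝ ↦ t ^ (x - 1) * (1 - t) ^ (y - 1) * Real.exp (-p / t - q / (1 - t)))
      (Ioo 0 1) := by
  have h := intervalIntegrable_rpow_mul_one_sub_rpow hx hy
  rw [intervalIntegrable_iff_integrableOn_Ioo_of_le zero_le_one] at h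
  refine Integrable.mul_bdd (c := 1) h (by fun_prop) ?_
  filter_upwards [ae_restrict_mem measurableSet_Ioo] with t ht
  rw [Real.norm_of_nonneg (Real.exp_nonneg _), Real.exp_le_one_iff, neg_div]
  have h₁ : 0 ≤ p / t := div_nonneg hp ht.1.le
  have h₂ : 0 ≤ q / (1 - t) := div_nonneg hq (sub_nonneg.2 ht.2.le)
  linarith

open MeasureTheory in
theorem extBeta_eq_setIntegral_Ioo (p q x y : ℝ) :
    extBeta p q x y = ∫ t in Set.Ioo (0 : ℝ) 1,
      t ^ (x - 1) * (1 - t) ^ (y - 1) * Real.exp (-p / t - q / (1 - t)) := by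
  rw [extBeta, intervalIntegral.integral_of_le zero_le_one, integral_Ioc_eq_integral_Ioo]

theorem extBeta_logConvex_in_pq (x y : ℝ) (hx : 0 < x) (hy : 0 < y)
    (p₁ p₂ q₁ q₂ : ℝ) (hp₁ : 0 < p₁) (hp₂ : 0 < p₂) (hq₁ : 0 < q₁) (hq₂ : 0 < q₂)
    (α : ℝ) (hα₀ : 0 ≤ α) (hα₁ : α ≤ 1) :
    extBeta (α * p₁ + (1 - α) * p₂) (α * q₁ + (1 - α) * q₂) x y ≤
      (extBeta p₁ q₁ x y) ^ α * (extBeta p₂ q₂ x y) ^ (1 - α) := by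
  have nonneg (p q : ℝ) : 0 ≤ᵐ[MeasureTheory.volume.restrict (Set.Ioo 0 1)] fun t : ℝ ↦
      t ^ (x - 1) * (1 - t) ^ (y - 1) * Real.exp (-p / t - q / (1 - t)) := by
    filter_upwards [MeasureTheory.ae_restrict_mem measurableSet_Ioo] with t ht
    have h₀ : 0 < t := ht.1
    have h₁ : 0 < 1 - t := sub_pos.2 ht.2
    simp only [Pi.zero_apply]
    positivity
  simp only [extBeta_eq_setIntegral_Ioo]
  refine le_of_eq_of_le (MeasureTheory.setIntegral_congr_fun measurableSet_Ioo fun t ht ↦ ?_)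
    (integral_rpow_mul_rpow_le (nonneg p₁ q₁) (nonneg p₂ q₂)
      (integrableOn_extBeta_integrand hp₁.le hq₁.le hx hy)
      (integrableOn_extBeta_integrand hp₂.le hq₂.le hx hy)
      hα₀ (sub_nonneg.2 hα₁) (add_sub_cancel _ _))
  have h₀ : 0 < t := ht.1
  have h₁ : 0 < 1 - t := sub_pos.2 ht.2
  have hw : 0 < t ^ (x - 1) * (1 - t) ^ (y - 1) := by positivity
  rw [Real.mul_rpow hw.le (Real.exp_nonneg _), Real.mul_rpow hw.le (Real.exp_nonneg _),
    mul_mul_mul_comm, ← Real.rpow_add hw, add_sub_cancel, Real.rpow_one, ← Real.exp_mul,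
    ← Real.exp_mul, ← Real.exp_add]
  ring_nf
end

section
/- Let β, γ be real numbers with γ > β > 0 and fix a real number x. Then for all p₁, p₂, q₁, q₂ > 0 and all α ∈ [0,1], Φ_{α p₁ + (1−α) p₂, α q₁ + (1−α) q₂}(β; γ; x) ≤ (Φ_{p₁,q₁}(β; γ; x))^α · (Φ_{p₂,q₂}(β; γ; x))^{1−α}; that is, the map (p,q) ↦ Φ_{p,q}(β; γ; x) is log-convex on (0,∞) × (0,∞). -/
/-- The classical Euler beta function `B(x,y) = ∫₀¹ t^(x-1) (1-t)^(y-1) dt`. -/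
noncomputable def eulerBeta (x y : ℝ) : ℝ :=
  ∫ t in (0:ℝ)..1, t ^ (x - 1) * (1 - t) ^ (y - 1)

/-- The extended `(p,q)`-confluent hypergeometric function
`Φ_{p,q}(β;γ;x) = (1/B(β,γ-β)) ∫₀¹ t^(β-1) (1-t)^(γ-β-1) exp(x t - p/t - q/(1-t)) dt`. -/
noncomputable def extPhi (p q β γ x : ℝ) : ℝ :=
  (1 / eulerBeta β (γ - β)) *
    ∫ t in (0:ℝ)..1, t ^ (β - 1) * (1 - t) ^ (γ - β - 1) * Real.exp (x * t - p / t - q / (1 - t))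

/-- The integrand in the definition of `extPhi`. -/
noncomputable def extPhiKernel (p q β γ x t : ℝ) : ℝ :=
  t ^ (β - 1) * (1 - t) ^ (γ - β - 1) * Real.exp (x * t - p / t - q / (1 - t))

open MeasureTheory in
/-- Hölder's inequality in log-convexity form. -/
theorem integral_rpow_mul_rpow_one_sub_le {Ω : Type*} [MeasurableSpace Ω] {μ : Measure Ω}
    {f g : Ω → ℝ} (hf : Integrable f μ) (hg : Integrable g μ) (hf₀ : 0 ≤ᵐ[μ] f) (hg₀ : 0 ≤ᵐ[μ] g)
    {a : ℝ} (ha₀ : 0 < a) (ha₁ : a < 1) :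
    ∫ ω, f ω ^ a * g ω ^ (1 - a) ∂μ ≤ (∫ ω, f ω ∂μ) ^ a * (∫ ω, g ω ∂μ) ^ (1 - a) := by
  have memLp_rpow {h : Ω → ℝ} (hh : Integrable h μ) (hh₀ : 0 ≤ᵐ[μ] h) {b : ℝ} (hb : 0 < b) :
      MemLp (fun ω => h ω ^ b) (ENNReal.ofReal b⁻¹) μ := by
    have := (memLp_one_iff_integrable.2 hh).norm_rpow_div (ENNReal.ofReal b)
    rw [one_div, ← ENNReal.ofReal_inv_of_pos hb, ENNReal.toReal_ofReal hb.le] at this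
    refine this.ae_eq ?_
    filter_upwards [hh₀] with ω hω
    rw [Real.norm_of_nonneg hω]
  have integral_rpow {h : Ω → ℝ} (hh₀ : 0 ≤ᵐ[μ] h) {b : ℝ} (hb : 0 < b) :
      ∫ ω, (h ω ^ b) ^ b⁻¹ ∂μ = ∫ ω, h ω ∂μ := by
    refine integral_congr_ae ?_
    filter_upwards [hh₀] with ω hω
    exact Real.rpow_rpow_inv hω hb.ne'
  have rpow_nonneg {h : Ω → ℝ} (hh₀ : 0 ≤ᵐ[μ] h) (b : ℝ) : 0 ≤ᵐ[μ] fun ω => h ω ^ b := by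
    filter_upwards [hh₀] with ω hω using Real.rpow_nonneg hω b
  have hb : 0 < 1 - a := sub_pos.2 ha₁
  have key := integral_mul_le_Lp_mul_Lq_of_nonneg
    (Real.HolderConjugate.inv_one_sub_inv ha₀ ha₁) (rpow_nonneg hf₀ a) (rpow_nonneg hg₀ (1 - a))
    (memLp_rpow hf hf₀ ha₀) (memLp_rpow hg hg₀ hb)
  rwa [integral_rpow hf₀ ha₀, integral_rpow hg₀ hb, one_div, inv_inv, one_div, inv_inv] at key

theorem extPhiKernel_nonneg (p q β γ x : ℝ) {t : ℝ} (ht : t ∈ Set.Ioo (0 : ℝ) 1) :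
    0 ≤ extPhiKernel p q β γ x t :=
  mul_nonneg (mul_nonneg (Real.rpow_nonneg ht.1.le _) (Real.rpow_nonneg (sub_pos.2 ht.2).le _))
    (Real.exp_pos _).le

theorem extPhiKernel_convexCombination (p₁ p₂ q₁ q₂ β γ x α : ℝ) {t : ℝ}
    (ht : t ∈ Set.Ioo (0 : ℝ) 1) :
    extPhiKernel (α * p₁ + (1 - α) * p₂) (α * q₁ + (1 - α) * q₂) β γ x t =
      extPhiKernel p₁ q₁ β γ x t ^ α * extPhiKernel p₂ q₂ β γ x t ^ (1 - α) := by
  unfold extPhiKernel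
  have hw : 0 < t ^ (β - 1) * (1 - t) ^ (γ - β - 1) :=
    mul_pos (Real.rpow_pos_of_pos ht.1 _) (Real.rpow_pos_of_pos (sub_pos.2 ht.2) _)
  generalize t ^ (β - 1) * (1 - t) ^ (γ - β - 1) = w at hw ⊢
  rw [Real.mul_rpow hw.le (Real.exp_pos _).le, Real.mul_rpow hw.le (Real.exp_pos _).le,
    ← Real.exp_mul, ← Real.exp_mul, mul_mul_mul_comm, ← Real.rpow_add hw, ← Real.exp_add,
    add_sub_cancel, Real.rpow_one]
  congr 2
  ring

open MeasureTheory in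
theorem integrableOn_beta_weight {u v : ℝ} (hu : 0 < u) (hv : 0 < v) :
    IntegrableOn (fun t : ℝ => t ^ (u - 1) * (1 - t) ^ (v - 1)) (Set.Ioo 0 1) := by
  have h := Complex.betaIntegral_convergent (u := u) (v := v) (by simpa) (by simpa)
  rw [intervalIntegrable_iff_integrableOn_Ioo_of_le zero_le_one] at h
  refine h.norm.congr ?_
  filter_upwards [ae_restrict_mem measurableSet_Ioo] with t ht
  have h1 : (1 - (t : ℂ)) = ((1 - t : ℝ) : ℂ) := by push_cast; rfl
  rw [norm_mul, h1, Complex.norm_cpow_eq_rpow_re_of_pos ht.1,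
    Complex.norm_cpow_eq_rpow_re_of_pos (sub_pos.2 ht.2)]
  simp

open MeasureTheory in
theorem integrableOn_extPhiKernel {p q β γ : ℝ} (x : ℝ) (hp : 0 ≤ p) (hq : 0 ≤ q) (hβ : 0 < β)
    (hγβ : β < γ) : IntegrableOn (extPhiKernel p q β γ x) (Set.Ioo 0 1) := by
  refine (integrableOn_beta_weight hβ (sub_pos.2 hγβ)).mul_bdd (c := Real.exp |x|)
    (by fun_prop) ?_
  filter_upwards [ae_restrict_mem measurableSet_Ioo] with t ht
  rw [Real.norm_of_nonneg (Real.exp_pos _).le, Real.exp_le_exp]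
  have h1 : 0 ≤ p / t := div_nonneg hp ht.1.le
  have h2 : 0 ≤ q / (1 - t) := div_nonneg hq (sub_pos.2 ht.2).le
  have h3 : x * t ≤ |x| :=
    (mul_le_mul_of_nonneg_right (le_abs_self x) ht.1.le).trans
      (mul_le_of_le_one_right (abs_nonneg x) ht.2.le)
  linarith

theorem eulerBeta_nonneg (x y : ℝ) : 0 ≤ eulerBeta x y :=
  intervalIntegral.integral_nonneg zero_le_one fun _ ht =>
    mul_nonneg (Real.rpow_nonneg ht.1 _) (Real.rpow_nonneg (sub_nonneg.2 ht.2) _)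

open MeasureTheory in
theorem extPhi_eq_setIntegral (p q β γ x : ℝ) :
    extPhi p q β γ x =
      (1 / eulerBeta β (γ - β)) * ∫ t in Set.Ioo (0 : ℝ) 1, extPhiKernel p q β γ x t := by
  rw [← integral_Ioc_eq_integral_Ioo, ← intervalIntegral.integral_of_le zero_le_one]
  rfl

theorem extPhi_logConvex_in_pq (β γ x : ℝ) (hβ : 0 < β) (hγβ : β < γ)
    (p₁ p₂ q₁ q₂ : ℝ) (hp₁ : 0 < p₁) (hp₂ : 0 < p₂) (hq₁ : 0 < q₁) (hq₂ : 0 < q₂)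
    (α : ℝ) (hα₀ : 0 ≤ α) (hα₁ : α ≤ 1) :
    extPhi (α * p₁ + (1 - α) * p₂) (α * q₁ + (1 - α) * q₂) β γ x ≤
      (extPhi p₁ q₁ β γ x) ^ α * (extPhi p₂ q₂ β γ x) ^ (1 - α) := by
  rcases hα₀.eq_or_lt with rfl | hα₀
  · simp
  rcases hα₁.eq_or_lt with rfl | hα₁
  · simp
  have kernel_nonneg (p q : ℝ) :
      0 ≤ᵐ[MeasureTheory.volume.restrict (Set.Ioo 0 1)] extPhiKernel p q β γ x := by
    filter_upwards [MeasureTheory.ae_restrict_mem measurableSet_Ioo] with t ht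
      using extPhiKernel_nonneg p q β γ x ht
  have holder := integral_rpow_mul_rpow_one_sub_le
    (integrableOn_extPhiKernel x hp₁.le hq₁.le hβ hγβ)
    (integrableOn_extPhiKernel x hp₂.le hq₂.le hβ hγβ)
    (kernel_nonneg p₁ q₁) (kernel_nonneg p₂ q₂) hα₀ hα₁
  have hC : 0 ≤ 1 / eulerBeta β (γ - β) := one_div_nonneg.2 (eulerBeta_nonneg _ _)
  simp only [extPhi_eq_setIntegral]
  rw [MeasureTheory.setIntegral_congr_fun measurableSet_Ioo fun t ht =>
      extPhiKernel_convexCombination p₁ p₂ q₁ q₂ β γ x α ht,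
    Real.mul_rpow hC (MeasureTheory.integral_nonneg_of_ae (kernel_nonneg p₁ q₁)),
    Real.mul_rpow hC (MeasureTheory.integral_nonneg_of_ae (kernel_nonneg p₂ q₂)),
    mul_mul_mul_comm, ← Real.rpow_add_of_nonneg hC hα₀.le (sub_pos.2 hα₁).le,
    add_sub_cancel, Real.rpow_one]
  exact mul_le_mul_of_nonneg_left holder hC
end

section
/- Let p, q > 0, let σ > 0 and let γ, x > 0 be fixed. Then for all β, β′ with 0 < β ≤ β′ and γ > β′ + σ, one has (B(β, γ) · Φ_{p,q}(β + σ; γ; x)) / (B(β + σ, γ) · Φ_{p,q}(β; γ; x)) ≥ (B(β′, γ) · Φ_{p,q}(β′ + σ; γ; x)) / (B(β′ + σ, γ) · Φ_{p,q}(β′; γ; x)); that is, the function β ↦ B(β, γ) Φ_{p,q}(β + σ; γ; x) / (B(β + σ, γ) Φ_{p,q}(β; γ; x)) is decreasing. -/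
open MeasureTheory Set

lemma betaKernel_intervalIntegrable {a b : ℝ} (ha : 0 < a) (hb : 0 < b) :
    IntervalIntegrable (fun t : ℝ => t ^ (a - 1) * (1 - t) ^ (b - 1)) volume 0 1 := by
  have h := Complex.betaIntegral_convergent (u := a) (v := b) (by simpa) (by simpa)
  rw [intervalIntegrable_iff_integrableOn_Ioo_of_le zero_le_one] at h ⊢
  refine IntegrableOn.congr_fun (Integrable.re h) (fun t ht => ?_) measurableSet_Ioo
  have h1 : (0 : ℝ) ≤ 1 - t := by linarith [ht.2]
  have e : (t : ℂ) ^ ((a : ℂ) - 1) * (1 - (t : ℂ)) ^ ((b : ℂ) - 1)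
      = ((t ^ (a - 1) * (1 - t) ^ (b - 1) : ℝ) : ℂ) := by
    rw [Complex.ofReal_mul, Complex.ofReal_cpow ht.1.le, Complex.ofReal_cpow h1]
    push_cast
    rfl
  simp only [e]
  exact Complex.ofReal_re _

lemma betaKernel_pos {a b t : ℝ} (ht : t ∈ Ioo (0 : ℝ) 1) :
    0 < t ^ (a - 1) * (1 - t) ^ (b - 1) :=
  mul_pos (Real.rpow_pos_of_pos ht.1 _) (Real.rpow_pos_of_pos (by linarith [ht.2]) _)

lemma eulerBeta_pos {a b : ℝ} (ha : 0 < a) (hb : 0 < b) : 0 < eulerBeta a b :=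
  intervalIntegral.intervalIntegral_pos_of_pos_on (betaKernel_intervalIntegrable ha hb)
    (fun _ ht => betaKernel_pos ht) one_pos

lemma mobius_denom_pos {m t : ℝ} (hm : 0 < m) (ht : t ∈ Icc (0 : ℝ) 1) : 0 < 1 - t + t * m := by
  rcases ht.1.eq_or_lt with h | h
  · simp [← h]
  · nlinarith [mul_pos h hm, ht.2]

lemma mobius_kernel_intervalIntegrable {a b m : ℝ} (c : ℝ) (ha : 0 < a) (hb : 0 < b)
    (hm : 0 < m) :
    IntervalIntegrable (fun t : ℝ => t ^ (a - 1) * (1 - t) ^ (b - 1) * (1 - t + t * m) ^ c)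
      volume 0 1 := by
  refine (betaKernel_intervalIntegrable ha hb).mul_continuousOn ?_
  rw [uIcc_of_le zero_le_one]
  exact ContinuousOn.rpow_const (by fun_prop) fun t ht => Or.inl (mobius_denom_pos hm ht).ne'

/-- The substitution `u = m t / (1 - t + m t)` in the beta integral. -/
lemma integral_mobius_kernel {a b m : ℝ} (hm : 0 < m) :
    ∫ t in (0 : ℝ)..1, t ^ (a - 1) * (1 - t) ^ (b - 1) * (1 - t + t * m) ^ (-(a + b))
      = m ^ (-a) * eulerBeta a b := by
  have hd : ∀ t ∈ Ioo (0 : ℝ) 1, 0 < 1 - t + t * m := fun t ht =>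
    mobius_denom_pos hm (Ioo_subset_Icc_self ht)
  set φ : ℝ → ℝ := fun t => t * m / (1 - t + t * m) with hφ
  have himg : φ '' Ioo 0 1 = Ioo 0 1 := by
    ext u
    constructor
    · rintro ⟨t, ht, rfl⟩
      have := hd t ht
      refine ⟨div_pos (mul_pos ht.1 hm) this, ?_⟩
      rw [div_lt_one this]
      linarith [ht.2]
    · intro hu
      have h1 : 0 < u + (1 - u) * m := by nlinarith [mul_pos (sub_pos.2 hu.2) hm, hu.1]
      refine ⟨u / (u + (1 - u) * m), ⟨div_pos hu.1 h1, ?_⟩, ?_⟩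
      · rw [div_lt_one h1]
        nlinarith [mul_pos (sub_pos.2 hu.2) hm]
      · have h2 : 1 - u / (u + (1 - u) * m) + u / (u + (1 - u) * m) * m
            = m / (u + (1 - u) * m) := by
          field_simp
          ring
        simp only [hφ]
        rw [h2]
        field_simp
  have hinj : InjOn φ (Ioo 0 1) := by
    intro s hs t ht h
    simp only [hφ] at h
    rw [div_eq_div_iff (hd s hs).ne' (hd t ht).ne'] at h
    have : m * (s - t) = 0 := by linear_combination h
    rcases mul_eq_zero.1 this with h | h
    · exact absurd h hm.ne'
    · linarith
  have hder : ∀ t ∈ Ioo (0 : ℝ) 1,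
      HasDerivWithinAt φ (m / (1 - t + t * m) ^ 2) (Ioo 0 1) t := by
    intro t ht
    have h1 : HasDerivAt (fun t : ℝ => t * m) m t := by
      simpa using (hasDerivAt_id t).mul_const m
    have h2 : HasDerivAt (fun t : ℝ => 1 - t + t * m) (-1 + m) t :=
      ((hasDerivAt_id t).const_sub 1).add h1
    have h3 := h1.div h2 (hd t ht).ne'
    refine (h3.congr_deriv ?_).hasDerivWithinAt
    congr 1
    ring
  have key := integral_image_eq_integral_abs_deriv_smul measurableSet_Ioo hder hinj
    (fun u => u ^ (a - 1) * (1 - u) ^ (b - 1))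
  rw [himg] at key
  rw [eulerBeta, intervalIntegral.integral_of_le zero_le_one, integral_Ioc_eq_integral_Ioo,
    intervalIntegral.integral_of_le zero_le_one, integral_Ioc_eq_integral_Ioo, key,
    ← integral_const_mul]
  refine setIntegral_congr_fun measurableSet_Ioo fun t ht => ?_
  have hD := hd t ht
  have h1t : 0 < 1 - t := by linarith [ht.2]
  have e : 1 - φ t = (1 - t) / (1 - t + t * m) := by
    simp only [hφ]
    field_simp
    ring
  simp only [smul_eq_mul]
  rw [e, abs_of_pos (by positivity)]
  simp only [hφ]
  rw [Real.div_rpow (mul_pos ht.1 hm).le hD.le, Real.div_rpow h1t.le hD.le,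
    Real.mul_rpow ht.1.le hm.le]
  have e1 : m ^ (-a) * m ^ (a - 1) * m = 1 := by
    rw [← Real.rpow_add hm, ← Real.rpow_add_one hm.ne']
    convert Real.rpow_zero m using 2
    ring
  have e2 : (1 - t + t * m) ^ (-(a + b)) * ((1 - t + t * m) ^ (a - 1)
      * (1 - t + t * m) ^ (b - 1) * (1 - t + t * m) ^ 2) = 1 := by
    rw [← Real.rpow_natCast, ← Real.rpow_add hD, ← Real.rpow_add hD, ← Real.rpow_add hD]
    convert Real.rpow_zero _ using 2
    push_cast
    ring
  have p1 := Real.rpow_pos_of_pos hD (a - 1)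
  have p2 := Real.rpow_pos_of_pos hD (b - 1)
  generalize (1 - t + t * m) ^ (-(a + b)) = E at *
  generalize (1 - t + t * m) ^ (a - 1) = E1 at *
  generalize (1 - t + t * m) ^ (b - 1) = E2 at *
  generalize (1 - t + t * m) = D at *
  generalize m ^ (-a) = M at *
  generalize m ^ (a - 1) = M1 at *
  field_simp
  linear_combination t ^ (a - 1) * (e2 - e1)

/-- A concave function lies above its chords inside and below them outside. -/
lemma ConcaveOn.chord_le_and_le_chord {s : Set ℝ} {f : ℝ → ℝ} (hf : ConcaveOn ℝ s f)
    {y₁ y₂ y : ℝ} (h₁ : y₁ ∈ s) (h₂ : y₂ ∈ s) (hy : y ∈ s) (h : y₁ < y₂) :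
    (y₁ ≤ y → y ≤ y₂ → f y₁ + (f y₂ - f y₁) / (y₂ - y₁) * (y - y₁) ≤ f y) ∧
    (y ≤ y₁ ∨ y₂ ≤ y → f y ≤ f y₁ + (f y₂ - f y₁) / (y₂ - y₁) * (y - y₁)) := by
  have hne : y₂ - y₁ ≠ 0 := (sub_pos.2 h).ne'
  have hC : (f y₂ - f y₁) / (y₂ - y₁) * (y₂ - y₁) = f y₂ - f y₁ := div_mul_cancel₀ _ hne
  set C := (f y₂ - f y₁) / (y₂ - y₁) with hCdef
  constructor
  · intro ha hb
    rcases ha.eq_or_lt with rfl | ha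
    · simp
    rcases hb.eq_or_lt with rfl | hb
    · linarith
    have := hf.slope_anti_adjacent h₁ h₂ ha hb
    rw [div_le_div_iff₀ (sub_pos.2 hb) (sub_pos.2 ha)] at this
    have : (f y₁ + C * (y - y₁)) * (y₂ - y₁) ≤ f y * (y₂ - y₁) := by
      linear_combination this + (y - y₁) * hC
    exact le_of_mul_le_mul_right this (sub_pos.2 h)
  · rintro (ha | hb)
    · rcases ha.eq_or_lt with rfl | ha
      · simp
      have := hf.slope_anti_adjacent hy h₂ ha h
      rw [← hCdef, le_div_iff₀ (sub_pos.2 ha)] at this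
      linarith
    · rcases hb.eq_or_lt with rfl | hb
      · linarith
      have := hf.slope_anti_adjacent h₁ hy h hb
      rw [← hCdef, div_le_iff₀ (sub_pos.2 hb)] at this
      linarith

/-- Variation diminishing for the beta kernel: if `v` is positive exactly on a subinterval of
`(0, 1)` bounded away from `1`, and two moments of `v` vanish, then the intermediate moments are
nonnegative. -/
lemma beta_moment_nonneg {γ θ₁ θ₂ θ τ : ℝ} {v : ℝ → ℝ} (h₁ : θ₁ ≤ θ) (h₂ : θ ≤ θ₂)
    (hlt : θ₁ < θ₂)
    (hint : ∀ s ∈ Icc θ₁ θ₂, IntervalIntegrable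
      (fun t : ℝ => t ^ (s - 1) * (1 - t) ^ (γ - s - 1) * v t) volume 0 1)
    (hconn : OrdConnected {t ∈ Ioo (0 : ℝ) 1 | 0 < v t})
    (hτ : τ < 1) (hvτ : ∀ t ∈ Ioo (0 : ℝ) 1, τ < t → v t ≤ 0)
    (hz₁ : ∫ t in (0 : ℝ)..1, t ^ (θ₁ - 1) * (1 - t) ^ (γ - θ₁ - 1) * v t = 0)
    (hz₂ : ∫ t in (0 : ℝ)..1, t ^ (θ₂ - 1) * (1 - t) ^ (γ - θ₂ - 1) * v t = 0) :
    0 ≤ ∫ t in (0 : ℝ)..1, t ^ (θ - 1) * (1 - t) ^ (γ - θ - 1) * v t := by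
  set S := {t ∈ Ioo (0 : ℝ) 1 | 0 < v t} with hS
  have I₁ := hint θ₁ ⟨le_rfl, hlt.le⟩
  have I₂ := hint θ₂ ⟨hlt.le, le_rfl⟩
  have I := hint θ ⟨h₁, h₂⟩
  by_cases hsub : S.Subsingleton
  · have hvle : ∀ᵐ t ∂volume.restrict (Ioc (0 : ℝ) 1), t ∈ Ioo (0 : ℝ) 1 ∧ v t ≤ 0 := by
      rw [← restrict_Ioo_eq_restrict_Ioc]
      filter_upwards [ae_restrict_mem measurableSet_Ioo,
        ae_restrict_of_ae (hsub.measure_zero volume |> measure_eq_zero_iff_ae_notMem.1)]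
        with t ht hn
      exact ⟨ht, not_lt.1 fun hv => hn ⟨ht, hv⟩⟩
    have hnn : 0 ≤ᵐ[volume.restrict (Ioc (0 : ℝ) 1)]
        fun t => -(t ^ (θ₁ - 1) * (1 - t) ^ (γ - θ₁ - 1) * v t) := by
      filter_upwards [hvle] with t ht
      exact neg_nonneg.2 (mul_nonpos_of_nonneg_of_nonpos (betaKernel_pos ht.1).le ht.2)
    have h0 := (intervalIntegral.integral_eq_zero_iff_of_le_of_nonneg_ae zero_le_one hnn
      I₁.neg).1 (by rw [intervalIntegral.integral_neg, hz₁, neg_zero])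
    rw [intervalIntegral.integral_of_le zero_le_one]
    refine integral_nonneg_of_ae ?_
    filter_upwards [h0, hvle] with t ht hm
    have hv : v t = 0 := by
      simpa [(betaKernel_pos hm.1).ne'] using ht
    simp [hv]
  obtain ⟨s₁, hs₁, s₂, hs₂, hs⟩ := (not_subsingleton_iff.1 hsub).exists_lt
  have hbb : BddBelow S := ⟨0, fun t ht => ht.1.1.le⟩
  have hτS : ∀ t ∈ S, t ≤ τ := fun t ht => not_lt.1 fun h => (hvτ t ht.1 h).not_gt ht.2
  have hba : BddAbove S := ⟨τ, hτS⟩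
  have hne : S.Nonempty := ⟨s₁, hs₁⟩
  set t₁ := sInf S
  set t₂ := sSup S
  have ht₁ : 0 ≤ t₁ := le_csInf hne fun t ht => ht.1.1.le
  have ht₂ : t₂ < 1 := (csSup_le hne hτS).trans_lt hτ
  have ht₁₂ : t₁ < t₂ := (csInf_le hbb hs₁).trans_lt (hs.trans_le (le_csSup hba hs₂))
  set δ := θ₂ - θ₁ with hδ
  have hδ0 : 0 < δ := sub_pos.2 hlt
  set y : ℝ → ℝ := fun t => (t / (1 - t)) ^ δ with hy
  have hy0 : ∀ t, 0 ≤ t → t < 1 → 0 ≤ y t := fun t h0 h1 =>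
    Real.rpow_nonneg (div_nonneg h0 (by linarith)) _
  have hyle : ∀ s t, 0 ≤ s → s ≤ t → t < 1 → y s ≤ y t := by
    intro s t h0 hst h1
    refine Real.rpow_le_rpow (div_nonneg h0 (by linarith)) ?_ hδ0.le
    rw [div_le_div_iff₀ (by linarith) (by linarith)]
    nlinarith
  have hylt : y t₁ < y t₂ := by
    refine Real.rpow_lt_rpow (div_nonneg ht₁ (by linarith)) ?_ hδ0
    rw [div_lt_div_iff₀ (by linarith) (by linarith)]
    nlinarith
  set lam := (θ - θ₁) / δ with hlam
  have hlam0 : 0 ≤ lam := div_nonneg (by linarith) hδ0.le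
  have hlam1 : lam ≤ 1 := (div_le_one hδ0).2 (by linarith)
  have hconc := Real.concaveOn_rpow hlam0 hlam1
  set C := (y t₂ ^ lam - y t₁ ^ lam) / (y t₂ - y t₁) with hC
  set A := y t₁ ^ lam - C * y t₁ with hA
  have hpt : ∀ t ∈ Ioo (0 : ℝ) 1, 0 ≤ (y t ^ lam - A - C * y t) * v t := by
    intro t ht
    have hch := hconc.chord_le_and_le_chord (mem_Ici.2 (hy0 t₁ ht₁ (ht₁₂.trans ht₂)))
      (mem_Ici.2 (hy0 t₂ (ht₁.trans ht₁₂.le) ht₂)) (mem_Ici.2 (hy0 t ht.1.le ht.2)) hylt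
    simp only [← hC] at hch
    rcases lt_or_ge 0 (v t) with hv | hv
    · have htS : t ∈ S := ⟨ht, hv⟩
      have := hch.1 (hyle _ _ ht₁ (csInf_le hbb htS) ht.2)
        (hyle _ _ ht.1.le (le_csSup hba htS) ht₂)
      exact mul_nonneg (by rw [hA]; linarith) hv.le
    · have hout : t ≤ t₁ ∨ t₂ ≤ t := by
        by_contra! hcon
        obtain ⟨a, ha, hat⟩ := exists_lt_of_csInf_lt hne hcon.1
        obtain ⟨b, hb, hbt⟩ := exists_lt_of_lt_csSup hne hcon.2
        exact hv.not_gt (hconn.out ha hb ⟨hat.le, hbt.le⟩).2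
      have := hch.2 (hout.imp (fun h => hyle _ _ ht.1.le h (ht₁₂.trans ht₂))
        (fun h => hyle _ _ (ht₁.trans ht₁₂.le) h ht.2))
      exact mul_nonneg_of_nonpos_of_nonpos (by rw [hA]; linarith) hv
  have hker : ∀ t ∈ Ioo (0 : ℝ) 1, ∀ s, t ^ (s - 1) * (1 - t) ^ (γ - s - 1)
      = t ^ (θ₁ - 1) * (1 - t) ^ (γ - θ₁ - 1) * (t / (1 - t)) ^ (s - θ₁) := by
    intro t ht s
    have h1t : 0 < 1 - t := by linarith [ht.2]
    rw [Real.div_rpow ht.1.le h1t.le, div_eq_mul_inv, ← Real.rpow_neg h1t.le,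
      mul_mul_mul_comm, ← Real.rpow_add ht.1, ← Real.rpow_add h1t]
    ring_nf
  have hsplit : ∫ t in (0 : ℝ)..1, t ^ (θ - 1) * (1 - t) ^ (γ - θ - 1) * v t
      = ∫ t in (0 : ℝ)..1, (t ^ (θ - 1) * (1 - t) ^ (γ - θ - 1) * v t
        - A * (t ^ (θ₁ - 1) * (1 - t) ^ (γ - θ₁ - 1) * v t)
        - C * (t ^ (θ₂ - 1) * (1 - t) ^ (γ - θ₂ - 1) * v t)) := by
    rw [intervalIntegral.integral_sub (I.sub (I₁.const_mul A)) (I₂.const_mul C),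
      intervalIntegral.integral_sub I (I₁.const_mul A), intervalIntegral.integral_const_mul,
      intervalIntegral.integral_const_mul, hz₁, hz₂]
    ring
  rw [hsplit, intervalIntegral.integral_of_le zero_le_one, integral_Ioc_eq_integral_Ioo]
  refine setIntegral_nonneg measurableSet_Ioo fun t ht => ?_
  have hyl : y t ^ lam = (t / (1 - t)) ^ (θ - θ₁) := by
    simp only [hy]
    rw [← Real.rpow_mul (div_nonneg ht.1.le (by linarith [ht.2])), hlam,
      mul_div_cancel₀ _ hδ0.ne']
  rw [hker t ht θ, hker t ht θ₂, ← hyl, ← hδ]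
  have := mul_nonneg (betaKernel_pos (a := θ₁) (b := γ - θ₁) ht).le (hpt t ht)
  simp only [hy] at this ⊢
  linarith

lemma extPhi_integrand_intervalIntegrable {p q a b : ℝ} (x : ℝ) (hp : 0 < p) (hq : 0 < q)
    (ha : 0 < a) (hb : 0 < b) :
    IntervalIntegrable (fun t : ℝ => t ^ (a - 1) * (1 - t) ^ (b - 1) *
      Real.exp (x * t - p / t - q / (1 - t))) volume 0 1 := by
  have h := betaKernel_intervalIntegrable ha hb
  rw [intervalIntegrable_iff_integrableOn_Ioo_of_le zero_le_one] at h ⊢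
  refine Integrable.mul_bdd (c := Real.exp |x|) h
    (Measurable.aestronglyMeasurable (by fun_prop)) ?_
  filter_upwards [ae_restrict_mem measurableSet_Ioo] with t ht
  rw [Real.norm_of_nonneg (Real.exp_pos _).le, Real.exp_le_exp]
  have h1 : 0 < p / t := div_pos hp ht.1
  have h2 : 0 < q / (1 - t) := div_pos hq (by linarith [ht.2])
  have h3 : x * t ≤ |x| := by nlinarith [le_abs_self x, abs_nonneg x, ht.1, ht.2]
  linarith

lemma extPhi_pos {p q β γ : ℝ} (x : ℝ) (hp : 0 < p) (hq : 0 < q) (hβ : 0 < β) (hγ : β < γ) :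
    0 < extPhi p q β γ x :=
  mul_pos (one_div_pos.2 (eulerBeta_pos hβ (sub_pos.2 hγ)))
    (intervalIntegral.intervalIntegral_pos_of_pos_on
      (extPhi_integrand_intervalIntegrable x hp hq hβ (sub_pos.2 hγ))
      (fun _ ht => mul_pos (betaKernel_pos ht) (Real.exp_pos _)) one_pos)

lemma concaveOn_log_weight {p q γ m : ℝ} (x : ℝ) (hp : 0 < p) (hq : 0 < q) (hγ : 0 < γ)
    (hm : 0 < m) :
    ConcaveOn ℝ (Ioo (0 : ℝ) 1)
      (fun t => x * t - p / t - q / (1 - t) + γ * Real.log (1 - t + t * m)) := by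
  have hlin : ConcaveOn ℝ (Ioo (0 : ℝ) 1) (fun t => x * t) := by
    refine ⟨convex_Ioo _ _, fun s _ t _ a b _ _ _ => le_of_eq ?_⟩
    simp only [smul_eq_mul]
    ring
  have hinv : ConvexOn ℝ (Ioi (0 : ℝ)) (fun t : ℝ => t⁻¹) := by
    simpa using convexOn_zpow (𝕜 := ℝ) (-1)
  have hinv1 : ConvexOn ℝ (Ioo (0 : ℝ) 1) (fun t => p / t) := by
    simpa [div_eq_mul_inv] using
      ((hinv.subset Ioo_subset_Ioi_self (convex_Ioo 0 1)).smul hp.le)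
  have hinv2 : ConvexOn ℝ (Ioo (0 : ℝ) 1) (fun t => q / (1 - t)) := by
    refine ⟨convex_Ioo _ _, fun s hs t ht a b ha hb hab => ?_⟩
    have := (hinv.smul hq.le).2 (sub_pos.2 hs.2) (sub_pos.2 ht.2) ha hb hab
    simp only [smul_eq_mul] at this
    simp only [smul_eq_mul, div_eq_mul_inv]
    rwa [show a * (1 - s) + b * (1 - t) = 1 - (a * s + b * t) by linear_combination hab] at this
  have hlog : ConcaveOn ℝ (Ioo (0 : ℝ) 1) (fun t => γ * Real.log (1 - t + t * m)) := by
    refine ⟨convex_Ioo _ _, fun s hs t ht a b ha hb hab => ?_⟩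
    have := (strictConcaveOn_log_Ioi.concaveOn.smul hγ.le).2
      (mobius_denom_pos hm (Ioo_subset_Icc_self hs))
      (mobius_denom_pos hm (Ioo_subset_Icc_self ht)) ha hb hab
    simp only [smul_eq_mul] at this ⊢
    rwa [show a * (1 - s + s * m) + b * (1 - t + t * m)
      = 1 - (a * s + b * t) + (a * s + b * t) * m by linear_combination hab] at this
  exact ((hlin.sub hinv1).sub hinv2).add hlog

/-- Between two points where it agrees with an exponential, `extPhi` lies above it. -/
lemma exp_le_extPhi {p q γ θ₁ θ₂ θ c a : ℝ} (x : ℝ) (hp : 0 < p) (hq : 0 < q) (hγ : 0 < γ)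
    (h0 : 0 < θ₁) (h₁ : θ₁ ≤ θ) (h₂ : θ ≤ θ₂) (hlt : θ₁ < θ₂) (hθγ : θ₂ < γ) (hc : 0 < c)
    (he₁ : extPhi p q θ₁ γ x = c * Real.exp (a * θ₁))
    (he₂ : extPhi p q θ₂ γ x = c * Real.exp (a * θ₂)) :
    c * Real.exp (a * θ) ≤ extPhi p q θ γ x := by
  set m := Real.exp (-a) with hmdef
  have hm : 0 < m := Real.exp_pos _
  set v : ℝ → ℝ := fun t =>
    Real.exp (x * t - p / t - q / (1 - t)) - c * (1 - t + t * m) ^ (-γ) with hv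
  have hI : ∀ s ∈ Icc θ₁ θ₂, IntervalIntegrable
      (fun t : ℝ => t ^ (s - 1) * (1 - t) ^ (γ - s - 1) * v t) volume 0 1 := by
    intro s hs
    have hs0 : 0 < s := h0.trans_le hs.1
    have hs1 : 0 < γ - s := by linarith [hs.2]
    convert (extPhi_integrand_intervalIntegrable x hp hq hs0 hs1).sub
      ((mobius_kernel_intervalIntegrable (-γ) hs0 hs1 hm).const_mul c) using 2
    simp only [hv]
    ring
  have hval : ∀ s ∈ Icc θ₁ θ₂, ∫ t in (0 : ℝ)..1, t ^ (s - 1) * (1 - t) ^ (γ - s - 1) * v t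
      = eulerBeta s (γ - s) * (extPhi p q s γ x - c * Real.exp (a * s)) := by
    intro s hs
    have hs0 : 0 < s := h0.trans_le hs.1
    have hs1 : 0 < γ - s := by linarith [hs.2]
    have hB := (eulerBeta_pos hs0 hs1).ne'
    have hmob := integral_mobius_kernel (a := s) (b := γ - s) hm
    rw [show -(s + (γ - s)) = -γ by ring] at hmob
    have hms : m ^ (-s) = Real.exp (a * s) := by
      rw [hmdef, ← Real.exp_mul]
      ring_nf
    calc _ = ∫ t in (0 : ℝ)..1, (t ^ (s - 1) * (1 - t) ^ (γ - s - 1) *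
            Real.exp (x * t - p / t - q / (1 - t))
          - c * (t ^ (s - 1) * (1 - t) ^ (γ - s - 1) * (1 - t + t * m) ^ (-γ))) := by
          congr 1
          ext t
          simp only [hv]
          ring
      _ = _ := by
          rw [intervalIntegral.integral_sub (extPhi_integrand_intervalIntegrable x hp hq hs0 hs1)
            ((mobius_kernel_intervalIntegrable (-γ) hs0 hs1 hm).const_mul c),
            intervalIntegral.integral_const_mul, hmob, hms, extPhi, mul_sub, one_div,
            mul_inv_cancel_left₀ hB]
          ring
  have hpos_iff : ∀ t ∈ Ioo (0 : ℝ) 1, (0 < v t ↔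
      Real.log c < x * t - p / t - q / (1 - t) + γ * Real.log (1 - t + t * m)) := by
    intro t ht
    have hD := mobius_denom_pos hm (Ioo_subset_Icc_self ht)
    have e : c * (1 - t + t * m) ^ (-γ)
        = Real.exp (Real.log c - γ * Real.log (1 - t + t * m)) := by
      rw [Real.rpow_def_of_pos hD, sub_eq_add_neg (Real.log c), Real.exp_add, Real.exp_log hc]
      ring_nf
    simp only [hv]
    rw [e, sub_pos, Real.exp_lt_exp, sub_lt_iff_lt_add]
  have hconn : OrdConnected {t ∈ Ioo (0 : ℝ) 1 | 0 < v t} := by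
    rw [show {t ∈ Ioo (0 : ℝ) 1 | 0 < v t} = _ from
      Set.ext fun t => and_congr_right fun ht => hpos_iff t ht]
    exact ((concaveOn_log_weight x hp hq hγ hm).convex_gt (Real.log c)).ordConnected
  set K := |x| + γ * m + |Real.log c| + 1 with hK
  have hK0 : 0 < K := by positivity
  have hτ : 1 - q / K < 1 := by linarith [div_pos hq hK0]
  have hvτ : ∀ t ∈ Ioo (0 : ℝ) 1, 1 - q / K < t → v t ≤ 0 := by
    intro t ht hlt
    rw [← not_lt, hpos_iff t ht, not_lt]
    have h1t : 0 < 1 - t := sub_pos.2 ht.2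
    have hD := mobius_denom_pos hm (Ioo_subset_Icc_self ht)
    have hlog : γ * Real.log (1 - t + t * m) ≤ γ * m := by
      refine mul_le_mul_of_nonneg_left ?_ hγ.le
      nlinarith [Real.log_le_sub_one_of_pos hD, ht.1, ht.2]
    have h3 : x * t ≤ |x| := by nlinarith [le_abs_self x, abs_nonneg x, ht.1, ht.2]
    have h4 : K ≤ q / (1 - t) := by
      rw [le_div_iff₀ h1t, mul_comm, ← le_div_iff₀ hK0]
      linarith
    linarith [div_pos hp ht.1, neg_abs_le (Real.log c)]
  have hmain := beta_moment_nonneg h₁ h₂ hlt hI hconn hτ hvτ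
    (by rw [hval θ₁ ⟨le_rfl, hlt.le⟩, he₁, sub_self, mul_zero])
    (by rw [hval θ₂ ⟨hlt.le, le_rfl⟩, he₂, sub_self, mul_zero])
  rw [hval θ ⟨h₁, h₂⟩] at hmain
  have := nonneg_of_mul_nonneg_right hmain
    (eulerBeta_pos (h0.trans_le h₁) (by linarith : 0 < γ - θ))
  linarith

lemma exists_exp_interpolation {u v l r : ℝ} (hu : 0 < u) (hv : 0 < v) (h : l < r) :
    ∃ c a : ℝ, 0 < c ∧ u = c * Real.exp (a * l) ∧ v = c * Real.exp (a * r) := by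
  have hne : r - l ≠ 0 := (sub_pos.2 h).ne'
  refine ⟨u * Real.exp (-((Real.log v - Real.log u) / (r - l) * l)),
    (Real.log v - Real.log u) / (r - l), by positivity, ?_, ?_⟩
  · rw [mul_assoc, ← Real.exp_add]
    simp
  · rw [mul_assoc, ← Real.exp_add, show -((Real.log v - Real.log u) / (r - l) * l)
      + (Real.log v - Real.log u) / (r - l) * r = Real.log v - Real.log u by field_simp; ring,
      Real.exp_sub, Real.exp_log hu, Real.exp_log hv]
    field_simp

lemma extPhi_mul_le {p q γ l m n r : ℝ} (x : ℝ) (hp : 0 < p) (hq : 0 < q) (hγ : 0 < γ)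
    (hl : 0 < l) (hr : r < γ) (hlt : l < r) (hm : m ∈ Icc l r) (hn : n ∈ Icc l r)
    (hsum : m + n = l + r) :
    extPhi p q l γ x * extPhi p q r γ x ≤ extPhi p q m γ x * extPhi p q n γ x := by
  obtain ⟨c, a, hc, el, er⟩ := exists_exp_interpolation
    (extPhi_pos x hp hq hl (hlt.trans hr)) (extPhi_pos x hp hq (hl.trans hlt) hr) hlt
  have bm := exp_le_extPhi x hp hq hγ hl hm.1 hm.2 hlt hr hc el er
  have bn := exp_le_extPhi x hp hq hγ hl hn.1 hn.2 hlt hr hc el er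
  calc extPhi p q l γ x * extPhi p q r γ x
      = c * c * Real.exp (a * (l + r)) := by
        rw [el, er, mul_add, Real.exp_add]
        ring
    _ = (c * Real.exp (a * m)) * (c * Real.exp (a * n)) := by
        rw [← hsum, mul_add, Real.exp_add]
        ring
    _ ≤ _ := mul_le_mul bm bn (by positivity) (le_trans (by positivity) bm)

/-- Between two points where it agrees with an exponential, the beta function lies below it. -/
lemma eulerBeta_le_exp {b θ₁ θ₂ θ c a : ℝ} (hb : 0 < b) (h0 : 0 < θ₁) (hlt : θ₁ < θ₂)
    (h : θ ∈ Icc θ₁ θ₂) (he₁ : eulerBeta θ₁ b = c * Real.exp (a * θ₁))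
    (he₂ : eulerBeta θ₂ b = c * Real.exp (a * θ₂)) :
    eulerBeta θ b ≤ c * Real.exp (a * θ) := by
  have I₁ := betaKernel_intervalIntegrable h0 hb
  have I₂ := betaKernel_intervalIntegrable (h0.trans hlt) hb
  have I := betaKernel_intervalIntegrable (h0.trans_le h.1) hb
  have hd : 0 < θ₂ - θ₁ := sub_pos.2 hlt
  set w₁ := (θ₂ - θ) / (θ₂ - θ₁) with hw₁
  set w₂ := (θ - θ₁) / (θ₂ - θ₁) with hw₂
  have hw₁0 : 0 ≤ w₁ := div_nonneg (by linarith [h.2]) hd.le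
  have hw₂0 : 0 ≤ w₂ := div_nonneg (by linarith [h.1]) hd.le
  have hw : w₁ + w₂ = 1 := by
    rw [hw₁, hw₂]
    field_simp
    ring
  have hθ : w₁ * θ₁ + w₂ * θ₂ = θ := by
    rw [hw₁, hw₂]
    field_simp
    ring
  have hmono := intervalIntegral.integral_mono_on_of_le_Ioo zero_le_one I
    ((I₁.const_mul (w₁ * Real.exp (a * (θ - θ₁)))).add
      (I₂.const_mul (w₂ * Real.exp (a * (θ - θ₂))))) (fun t ht => by
      have key : ∀ s, t ^ (s - 1) = Real.exp ((Real.log t - a) * s) * Real.exp (a * s)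
          * t ^ (-1 : ℝ) := by
        intro s
        rw [← Real.exp_add, show (Real.log t - a) * s + a * s = Real.log t * s by ring,
          ← Real.rpow_def_of_pos ht.1, ← Real.rpow_add ht.1, sub_eq_add_neg]
      have hcx := convexOn_exp.2 (mem_univ ((Real.log t - a) * θ₁))
        (mem_univ ((Real.log t - a) * θ₂)) hw₁0 hw₂0 hw
      simp only [smul_eq_mul] at hcx
      rw [show w₁ * ((Real.log t - a) * θ₁) + w₂ * ((Real.log t - a) * θ₂)
        = (Real.log t - a) * θ by rw [← hθ]; ring] at hcx
      have e₁ : Real.exp (a * (θ - θ₁)) * Real.exp (a * θ₁) = Real.exp (a * θ) := by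
        rw [← Real.exp_add]
        ring_nf
      have e₂ : Real.exp (a * (θ - θ₂)) * Real.exp (a * θ₂) = Real.exp (a * θ) := by
        rw [← Real.exp_add]
        ring_nf
      have hnn : 0 ≤ Real.exp (a * θ) * t ^ (-1 : ℝ) * (1 - t) ^ (b - 1) :=
        mul_nonneg (mul_nonneg (Real.exp_pos _).le (Real.rpow_nonneg ht.1.le _))
          (Real.rpow_nonneg (by linarith [ht.2]) _)
      have hfin := mul_le_mul_of_nonneg_right hcx hnn
      rw [key θ, key θ₁, key θ₂]
      refine le_trans (le_of_eq (by ring)) (hfin.trans (le_of_eq ?_))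
      linear_combination
        -(w₁ * Real.exp ((Real.log t - a) * θ₁) * t ^ (-1 : ℝ) * (1 - t) ^ (b - 1)) * e₁
        - (w₂ * Real.exp ((Real.log t - a) * θ₂) * t ^ (-1 : ℝ) * (1 - t) ^ (b - 1)) * e₂)
  rw [intervalIntegral.integral_add (I₁.const_mul _) (I₂.const_mul _),
    intervalIntegral.integral_const_mul, intervalIntegral.integral_const_mul] at hmono
  change eulerBeta θ b ≤ _ * eulerBeta θ₁ b + _ * eulerBeta θ₂ b at hmono
  refine hmono.trans (le_of_eq ?_)
  have e₁ : Real.exp (a * (θ - θ₁)) * Real.exp (a * θ₁) = Real.exp (a * θ) := by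
    rw [← Real.exp_add]
    ring_nf
  have e₂ : Real.exp (a * (θ - θ₂)) * Real.exp (a * θ₂) = Real.exp (a * θ) := by
    rw [← Real.exp_add]
    ring_nf
  rw [he₁, he₂]
  linear_combination w₁ * c * e₁ + w₂ * c * e₂ + c * Real.exp (a * θ) * hw

lemma eulerBeta_mul_le {b l m n r : ℝ} (hb : 0 < b) (hl : 0 < l) (hlt : l < r)
    (hm : m ∈ Icc l r) (hn : n ∈ Icc l r) (hsum : m + n = l + r) :
    eulerBeta m b * eulerBeta n b ≤ eulerBeta l b * eulerBeta r b := by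
  obtain ⟨c, a, hc, el, er⟩ := exists_exp_interpolation
    (eulerBeta_pos hl hb) (eulerBeta_pos (hl.trans hlt) hb) hlt
  calc eulerBeta m b * eulerBeta n b
      ≤ (c * Real.exp (a * m)) * (c * Real.exp (a * n)) :=
        mul_le_mul (eulerBeta_le_exp hb hl hlt hm el er) (eulerBeta_le_exp hb hl hlt hn el er)
          (eulerBeta_pos (hl.trans_le hn.1) hb).le (by positivity)
    _ = c * c * Real.exp (a * (l + r)) := by
        rw [← hsum, mul_add, Real.exp_add]
        ring
    _ = _ := by
        rw [el, er, mul_add, Real.exp_add]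
        ring

theorem extPhi_ratio_decreasing_in_beta (p q σ γ x : ℝ) (hp : 0 < p) (hq : 0 < q)
    (hσ : 0 < σ) (hγ : 0 < γ) (hx : 0 < x)
    (β β' : ℝ) (hβ : 0 < β) (hββ' : β ≤ β') (hγβ' : β' + σ < γ) :
    (eulerBeta β' γ * extPhi p q (β' + σ) γ x) / (eulerBeta (β' + σ) γ * extPhi p q β' γ x) ≤
      (eulerBeta β γ * extPhi p q (β + σ) γ x) / (eulerBeta (β + σ) γ * extPhi p q β γ x) := by
  have hl : β < β' + σ := by linarith
  have h₁ : β' ∈ Icc β (β' + σ) := ⟨hββ', by linarith⟩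
  have h₂ : β + σ ∈ Icc β (β' + σ) := ⟨by linarith, by linarith⟩
  have hsum : β' + (β + σ) = β + (β' + σ) := by ring
  have hB := eulerBeta_mul_le hγ hβ hl h₁ h₂ hsum
  have hΦ := extPhi_mul_le x hp hq hγ hβ hγβ' hl h₁ h₂ hsum
  have b₁ : 0 < eulerBeta β γ := eulerBeta_pos hβ hγ
  have b₂ : 0 < eulerBeta (β' + σ) γ := eulerBeta_pos (by linarith) hγ
  have b₃ : 0 < eulerBeta (β + σ) γ := eulerBeta_pos (by linarith) hγ
  have f₁ : 0 < extPhi p q β γ x := extPhi_pos x hp hq hβ (by linarith)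
  have f₂ : 0 < extPhi p q (β' + σ) γ x := extPhi_pos x hp hq (by linarith) hγβ'
  have f₃ : 0 < extPhi p q β' γ x := extPhi_pos x hp hq (by linarith) (by linarith)
  rw [div_le_div_iff₀ (mul_pos b₂ f₃) (mul_pos b₃ f₁)]
  have := mul_le_mul hB hΦ (mul_pos f₁ f₂).le (mul_pos b₁ b₂).le
  linarith
end
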